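/- arXiv:1909.10979 — 7 statements merged into one kernel-verified Lean document; each statement's English description precedes it below -/
import Mathlib

section
/- Let N ≥ 2 be even and set k = N/2. Let c_1,…,c_{N−1} ∈ {0,1} and suppose x : ℝ → ℂ^N is a magnetless soliton with phase α = −1 satisfying the k-wall boundary conditions determined by this c-sequence. Write Δσ = 2π((1/2)ρ − Σ_{j=1}^{N−1} c_j w_j) for the difference of the boundary values of σ = Im x. Then α_N · Δσ ≠ 0 and there exists a sequence d_1,…,d_N with each d_a ∈ {−1, 1} such that: (i) d_N = 1 and α_a · Δσ = d_a (α_N · Δσ) for every a = 1,…,N; (ii) Σ_{a=1}^N d_a = 0; (iii) d_a (d_{N−1} + d_1) = d_{a+1} + d_{a−1} for every a = 1,…,N, where indices are taken cyclically modulo N (d_0 = d_N, d_{N+1} = d_1). -/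
open Filter Real Finset

noncomputable section

/-- The simple roots `α_a = e_a - e_{a+1}` for `a = 1,…,N-1` and the affine root
`α_N = e_N - e_1` of `su(N)`, with 1-based index `a`. -/
def suRoot (N a : ℕ) : Fin N → ℝ := fun i =>
  (if (i : ℕ) + 1 = a then 1 else 0) - (if (i : ℕ) + 1 = a % N + 1 then 1 else 0)

/-- The fundamental weights `w_b = e_1 + ⋯ + e_b - (b/N)(e_1 + ⋯ + e_N)` for
`b = 1,…,N-1`, with the conventions `w_0 = w_N = 0` (the formula realizes them). -/
def suWeight (N b : ℕ) : Fin N → ℝ := fun i =>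
  (if (i : ℕ) + 1 ≤ b then 1 else 0) - (b : ℝ) / N

/-- The Weyl vector `ρ = w_1 + ⋯ + w_{N-1}`. -/
def weylVector (N : ℕ) : Fin N → ℝ := fun i => ∑ b ∈ Finset.Icc 1 (N - 1), suWeight N b i

/-- Euclidean inner product on `ℝ^N`. -/
def dotR {N : ℕ} (v w : Fin N → ℝ) : ℝ := ∑ i, v i * w i

/-- Complex-bilinear extension of the Euclidean inner product. -/
def dotC {N : ℕ} (v : Fin N → ℝ) (y : Fin N → ℂ) : ℂ := ∑ i, (v i : ℂ) * y i

/-- A BPS soliton with phase `α`: a differentiable `x : ℝ → ℂ^N` with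
`dx/dz = (α/2) ∑_{a=1}^N exp(α_a ⋅ conj (x z)) α_a`. -/
def IsBPSSoliton (N : ℕ) (α : ℂ) (x : ℝ → Fin N → ℂ) : Prop :=
  ∀ z : ℝ, HasDerivAt x
    (fun i => α / 2 * ∑ a ∈ Finset.Icc 1 N,
      Complex.exp (dotC (suRoot N a) (fun j => (starRingEnd ℂ) (x z j))) * (suRoot N a i : ℂ)) z

/-- A magnetless soliton has vanishing real part. -/
def IsMagnetless (N : ℕ) (x : ℝ → Fin N → ℂ) : Prop :=
  ∀ (z : ℝ) (i : Fin N), (x z i).re = 0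

/-- The `k`-wall boundary conditions determined by a c-sequence `c`:
`x → 2πi ∑_j c_j w_j` at `-∞` and `x → 2πi (k/N) ρ` at `+∞`. -/
def KWallBC (N k : ℕ) (c : ℕ → ℝ) (x : ℝ → Fin N → ℂ) : Prop :=
  Tendsto x atBot (nhds (fun i =>
      2 * (π : ℂ) * Complex.I * ∑ j ∈ Finset.Icc 1 (N - 1), (c j : ℂ) * (suWeight N j i : ℂ)))
  ∧ Tendsto x atTop (nhds (fun i =>
      2 * (π : ℂ) * Complex.I * ((k : ℂ) / N) * (weylVector N i : ℂ)))

lemma dotR_suRoot {N a : ℕ} (ha : a ∈ Finset.Icc 1 N) (v : Fin N → ℝ) :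
    dotR (suRoot N a) v =
      v ⟨a - 1, by rw [Finset.mem_Icc] at ha; omega⟩ -
        v ⟨a % N, Nat.mod_lt _ (by rw [Finset.mem_Icc] at ha; omega)⟩ := by
  obtain ⟨h1, h2⟩ := Finset.mem_Icc.1 ha
  have e1 : ∀ i : Fin N, (i : ℕ) + 1 = a ↔ i = ⟨a - 1, by omega⟩ := fun i => by
    rw [Fin.ext_iff]; simp only; omega
  have e2 : ∀ i : Fin N, (i : ℕ) + 1 = a % N + 1 ↔ i = ⟨a % N, Nat.mod_lt _ (by omega)⟩ :=
    fun i => by rw [Fin.ext_iff]; simp only; omega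
  simp only [dotR, suRoot, sub_mul, Finset.sum_sub_distrib, e1, e2]
  simp

/-- Every fundamental weight pairs with the affine root to `-1`. -/
lemma dotR_affineRoot_suWeight {N b : ℕ} (hb : b ∈ Finset.Icc 1 (N - 1)) :
    dotR (suRoot N N) (suWeight N b) = -1 := by
  obtain ⟨h1, h2⟩ := Finset.mem_Icc.1 hb
  rw [dotR_suRoot (Finset.mem_Icc.2 ⟨by omega, le_rfl⟩)]
  have e1 : ¬ N - 1 + 1 ≤ b := by omega
  simp only [suWeight, e1, Nat.mod_self, zero_add, h1, if_true, if_false]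
  ring

lemma dotR_sum_right {N : ℕ} {ι : Type*} (s : Finset ι) (v : Fin N → ℝ) (c : ι → ℝ)
    (w : ι → Fin N → ℝ) :
    dotR v (fun i => ∑ j ∈ s, c j * w j i) = ∑ j ∈ s, c j * dotR v (w j) := by
  simp only [dotR, Finset.mul_sum]
  rw [Finset.sum_comm]
  exact Finset.sum_congr rfl fun j _ => Finset.sum_congr rfl fun i _ => by ring

lemma dotR_smul_right {N : ℕ} (v w : Fin N → ℝ) (t : ℝ) :
    dotR v (fun i => t * w i) = t * dotR v w := by
  simp only [dotR, Finset.mul_sum]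
  exact Finset.sum_congr rfl fun i _ => by ring

lemma dotR_sub_right {N : ℕ} (v w w' : Fin N → ℝ) :
    dotR v (fun i => w i - w' i) = dotR v w - dotR v w' := by
  simp only [dotR, mul_sub, Finset.sum_sub_distrib]

lemma dotR_affineRoot_weylVector {N : ℕ} (hN : 1 ≤ N) :
    dotR (suRoot N N) (weylVector N) = 1 - N := by
  have h := dotR_sum_right (Finset.Icc 1 (N - 1)) (suRoot N N) (fun _ => 1) (suWeight N)
  simp only [one_mul] at h
  unfold weylVector
  rw [h, Finset.sum_congr rfl fun b hb => dotR_affineRoot_suWeight hb]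
  simp [Nat.cast_sub hN]

lemma sum_mul_suRoot {N : ℕ} (f : ℕ → ℝ) (i : Fin N) :
    ∑ a ∈ Finset.Icc 1 N, f a * suRoot N a i =
      f (i + 1) - f (if (i : ℕ) = 0 then N else i) := by
  have hi := i.2
  have e2 : ∀ a ∈ Finset.Icc 1 N, ((i : ℕ) + 1 = a % N + 1 ↔
      (if (i : ℕ) = 0 then N else i) = a) := fun a ha => by
    obtain ⟨h1, h2⟩ := Finset.mem_Icc.1 ha
    rcases h2.lt_or_eq with h | h
    · rw [Nat.mod_eq_of_lt h]; split_ifs <;> omega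
    · subst h; rw [Nat.mod_self]; split_ifs <;> omega
  have m1 : (i : ℕ) + 1 ∈ Finset.Icc 1 N := Finset.mem_Icc.2 ⟨by omega, by omega⟩
  have m2 : (if (i : ℕ) = 0 then N else i) ∈ Finset.Icc 1 N := by
    rw [Finset.mem_Icc]; split_ifs <;> omega
  simp only [suRoot, mul_sub, Finset.sum_sub_distrib]
  congr 1
  · simp [Finset.sum_ite_eq]
  · rw [Finset.sum_congr rfl fun a ha => by rw [if_congr (e2 a ha) rfl rfl]]
    simp only [mul_ite, mul_one, mul_zero, Finset.sum_ite_eq, m2, if_true]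

/-- The roots pair with a combination of roots through the affine Cartan matrix. -/
lemma dotR_suRoot_sum_mul_suRoot {N a : ℕ} (ha : a ∈ Finset.Icc 1 N) (f : ℕ → ℝ) :
    dotR (suRoot N a) (fun i => ∑ b ∈ Finset.Icc 1 N, f b * suRoot N b i) =
      2 * f a - f (if a = 1 then N else a - 1) - f (if a = N then 1 else a + 1) := by
  obtain ⟨h1, h2⟩ := Finset.mem_Icc.1 ha
  rw [dotR_suRoot ha, sum_mul_suRoot, sum_mul_suRoot]
  have e1 : a - 1 + 1 = a := by omega
  have e2 : (if a - 1 = 0 then N else a - 1) = if a = 1 then N else a - 1 := by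
    split_ifs <;> omega
  have e3 : a % N + 1 = if a = N then 1 else a + 1 := by
    rcases h2.lt_or_eq with h | h
    · rw [Nat.mod_eq_of_lt h, if_neg h.ne]
    · subst h; simp
  have e4 : (if a % N = 0 then N else a % N) = a := by
    rcases h2.lt_or_eq with h | h
    · rw [Nat.mod_eq_of_lt h]; split_ifs <;> omega
    · subst h; simp
  simp only [e1, e2, e3, e4]
  ring

lemma sum_dotR_suRoot {N : ℕ} (v : Fin N → ℝ) :
    ∑ a ∈ Finset.Icc 1 N, dotR (suRoot N a) v = 0 := by
  simp only [dotR]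
  rw [Finset.sum_comm]
  refine Finset.sum_eq_zero fun i _ => ?_
  have h := sum_mul_suRoot (fun _ => v i) i
  rw [sub_self] at h
  rw [← h]
  exact Finset.sum_congr rfl fun a _ => mul_comm _ _

lemma tendsto_dotR {N : ℕ} {ι : Type*} {l : Filter ι} (v : Fin N → ℝ) {f : ι → Fin N → ℝ}
    {L : Fin N → ℝ} (h : Tendsto f l (nhds L)) :
    Tendsto (fun z => dotR v (f z)) l (nhds (dotR v L)) :=
  tendsto_finsetSum _ fun i _ => (tendsto_pi_nhds.1 h i).const_mul (v i)

lemma dotC_conj_of_re_eq_zero {N : ℕ} (v : Fin N → ℝ) {y : Fin N → ℂ} (hy : ∀ i, (y i).re = 0) :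
    dotC v (fun j => (starRingEnd ℂ) (y j)) =
      ((-dotR v (fun j => (y j).im) : ℝ) : ℂ) * Complex.I := by
  simp only [dotC, dotR, Complex.ofReal_neg, Complex.ofReal_sum, neg_mul, Finset.sum_mul,
    ← Finset.sum_neg_distrib]
  refine Finset.sum_congr rfl fun i _ => ?_
  apply Complex.ext <;> simp [hy i]

/-- A function whose derivative is dominated by a multiple of its value vanishes identically as
soon as it vanishes somewhere. -/
lemma eq_zero_of_abs_deriv_le {φ φ' : ℝ → ℝ} {K z₀ : ℝ} (hφ : ∀ z, HasDerivAt φ (φ' z) z)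
    (hK : ∀ z, |φ' z| ≤ K * |φ z|) (h₀ : φ z₀ = 0) (z : ℝ) : φ z = 0 := by
  have key : ∀ z, |φ z * φ' z| ≤ K * φ z ^ 2 := fun z => by
    rw [abs_mul, ← sq_abs]
    nlinarith [mul_le_mul_of_nonneg_left (hK z) (abs_nonneg (φ z))]
  have hd : ∀ m z : ℝ, HasDerivAt (fun t => φ t ^ 2 * Real.exp (m * t))
      ((2 * (φ z * φ' z) + m * φ z ^ 2) * Real.exp (m * z)) z := fun m z => by
    have h := ((hφ z).pow 2).mul (((hasDerivAt_id z).const_mul m).exp)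
    refine h.congr_deriv ?_
    simp only [Nat.cast_ofNat, Nat.add_one_sub_one, pow_one, mul_one, Pi.pow_apply, id]
    ring
  have concl : ∀ m : ℝ, φ z ^ 2 * Real.exp (m * z) ≤ 0 → φ z = 0 := fun m h => by
    have := nonpos_of_mul_nonpos_left h (Real.exp_pos _)
    exact pow_eq_zero_iff two_ne_zero |>.1 (le_antisymm this (sq_nonneg _))
  rcases le_total z₀ z with h | h
  · have anti : Antitone fun t => φ t ^ 2 * Real.exp (-(2 * K) * t) :=
      antitone_of_hasDerivAt_nonpos (hd _) fun t =>
        mul_nonpos_of_nonpos_of_nonneg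
          (by nlinarith [(abs_le.1 (key t)).2]) (Real.exp_pos _).le
    exact concl (-(2 * K)) (by simpa [h₀] using anti h)
  · have mono : Monotone fun t => φ t ^ 2 * Real.exp (2 * K * t) :=
      monotone_of_hasDerivAt_nonneg (hd _) fun t =>
        mul_nonneg (by nlinarith [(abs_le.1 (key t)).1]) (Real.exp_pos _).le
    exact concl (2 * K) (by simpa [h₀] using mono h)

/-- The angles `θ a = α_a ⋅ σ` along a magnetless soliton with phase `-1`. -/
lemma magnetless_angles {N : ℕ} {x : ℝ → Fin N → ℂ} (hx : IsBPSSoliton N (-1) x)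
    (hmag : IsMagnetless N x) {a : ℕ} (ha : a ∈ Finset.Icc 1 N) (z : ℝ) :
    Real.cos (dotR (suRoot N a) fun i => (x z i).im) =
        Real.cos (dotR (suRoot N N) fun i => (x z i).im) ∧
      HasDerivAt (fun z => dotR (suRoot N a) fun i => (x z i).im)
        (1 / 2 * (2 * Real.sin (dotR (suRoot N a) fun i => (x z i).im)
          - Real.sin (dotR (suRoot N (if a = 1 then N else a - 1)) fun i => (x z i).im)
          - Real.sin (dotR (suRoot N (if a = N then 1 else a + 1)) fun i => (x z i).im))) z := by
  set θ : ℕ → ℝ := fun a => dotR (suRoot N a) fun i => (x z i).im with hθ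
  have hexp : ∀ b, Complex.exp (dotC (suRoot N b) (fun j => (starRingEnd ℂ) (x z j))) =
      (Real.cos (θ b) : ℂ) - (Real.sin (θ b) : ℂ) * Complex.I := fun b => by
    rw [dotC_conj_of_re_eq_zero _ (hmag z), Complex.exp_mul_I, ← Complex.ofReal_cos,
      ← Complex.ofReal_sin, Real.cos_neg, Real.sin_neg]
    push_cast; ring
  have hder := fun i => hasDerivAt_pi.1 (hx z) i
  simp only [hexp] at hder
  have hsplit : ∀ i, (-1 / 2 * ∑ b ∈ Finset.Icc 1 N,
      ((Real.cos (θ b) : ℂ) - (Real.sin (θ b) : ℂ) * Complex.I) * (suRoot N b i : ℂ)) =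
      ((-1 / 2 * ∑ b ∈ Finset.Icc 1 N, Real.cos (θ b) * suRoot N b i : ℝ) : ℂ) +
      ((1 / 2 * ∑ b ∈ Finset.Icc 1 N, Real.sin (θ b) * suRoot N b i : ℝ) : ℂ) * Complex.I := by
    intro i
    push_cast
    simp only [Finset.mul_sum, Finset.sum_mul, ← Finset.sum_add_distrib]
    exact Finset.sum_congr rfl fun b _ => by ring
  simp only [hsplit] at hder
  have hre : ∀ i : Fin N, Real.cos (θ (i + 1)) = Real.cos (θ (if (i : ℕ) = 0 then N else i)) := by
    intro i
    have h1 := Complex.reCLM.hasFDerivAt.comp_hasDerivAt z (hder i)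
    have h2 : HasDerivAt (fun t => (x t i).re) 0 z := by
      simp only [hmag _ i]; exact hasDerivAt_const _ _
    have h3 := h2.unique h1
    rw [sum_mul_suRoot (fun b => Real.cos (θ b))] at h3
    simp only [Complex.reCLM_apply, Complex.add_re, Complex.ofReal_re, Complex.re_ofReal_mul,
      Complex.I_re, mul_zero, add_zero] at h3
    linarith
  have him : ∀ i : Fin N, HasDerivAt (fun t => (x t i).im)
      (1 / 2 * ∑ b ∈ Finset.Icc 1 N, Real.sin (θ b) * suRoot N b i) z := fun i => by
    have h1 := Complex.imCLM.hasFDerivAt.comp_hasDerivAt z (hder i)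
    refine h1.congr_deriv ?_
    simp only [Complex.imCLM_apply, Complex.add_im, Complex.ofReal_im, Complex.im_ofReal_mul,
      Complex.I_im, mul_one, zero_add]
  refine ⟨?_, ?_⟩
  · have hind : ∀ n, n + 1 ≤ N → Real.cos (θ (n + 1)) = Real.cos (θ N) := by
      intro n
      induction n with
      | zero => intro h; simpa using hre ⟨0, h⟩
      | succ n ih => intro h; simpa [ih (by omega)] using hre ⟨n + 1, h⟩
    obtain ⟨h1, h2⟩ := Finset.mem_Icc.1 ha
    have := hind (a - 1) (by omega)
    rwa [Nat.sub_add_cancel h1] at this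
  · have h := HasDerivAt.fun_sum (u := Finset.univ) fun i _ => (him i).const_mul (suRoot N a i)
    rw [← dotR_suRoot_sum_mul_suRoot ha (fun b => Real.sin (θ b)), ← dotR_smul_right]
    exact h

/-- the d-sequence of a magnetless soliton exists and satisfies the three
conditions of Lemma 3 of the paper. -/
theorem magnetless_dSequence (N : ℕ) (hN : 2 ≤ N) (hNeven : Even N)
    (c : ℕ → ℝ) (hc : ∀ j ∈ Finset.Icc 1 (N - 1), c j = 0 ∨ c j = 1)
    (x : ℝ → Fin N → ℂ) (hx : IsBPSSoliton N (-1) x) (hmag : IsMagnetless N x)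
    (hbc : KWallBC N (N / 2) c x)
    (Δσ : Fin N → ℝ)
    (hΔσ : Δσ = fun i => 2 * π * ((1 / 2) * weylVector N i -
      ∑ j ∈ Finset.Icc 1 (N - 1), c j * suWeight N j i)) :
    dotR (suRoot N N) Δσ ≠ 0 ∧
    ∃ d : ℕ → ℝ,
      (∀ a ∈ Finset.Icc 1 N, d a = -1 ∨ d a = 1) ∧
      d N = 1 ∧
      (∀ a ∈ Finset.Icc 1 N, dotR (suRoot N a) Δσ = d a * dotR (suRoot N N) Δσ) ∧
      (∑ a ∈ Finset.Icc 1 N, d a) = 0 ∧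
      (∀ a ∈ Finset.Icc 1 N,
        d a * (d (N - 1) + d 1) =
          (if a = N then d 1 else d (a + 1)) + (if a = 1 then d N else d (a - 1))) := by
  set θ : ℕ → ℝ → ℝ := fun a z => dotR (suRoot N a) fun i => (x z i).im with hθ
  have hNmem : N ∈ Finset.Icc 1 N := Finset.mem_Icc.2 ⟨by omega, le_rfl⟩
  have hpred : ∀ a ∈ Finset.Icc 1 N, (if a = 1 then N else a - 1) ∈ Finset.Icc 1 N :=
    fun a ha => by rw [Finset.mem_Icc] at *; split_ifs <;> omega
  have hsucc : ∀ a ∈ Finset.Icc 1 N, (if a = N then 1 else a + 1) ∈ Finset.Icc 1 N :=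
    fun a ha => by rw [Finset.mem_Icc] at *; split_ifs <;> omega
  have hcos : ∀ a ∈ Finset.Icc 1 N, ∀ z, Real.cos (θ a z) = Real.cos (θ N z) :=
    fun a ha z => (magnetless_angles hx hmag ha z).1
  have hder : ∀ a ∈ Finset.Icc 1 N, ∀ z, HasDerivAt (θ a)
      (1 / 2 * (2 * Real.sin (θ a z) - Real.sin (θ (if a = 1 then N else a - 1) z)
        - Real.sin (θ (if a = N then 1 else a + 1) z))) z :=
    fun a ha z => (magnetless_angles hx hmag ha z).2
  have hcont : ∀ a ∈ Finset.Icc 1 N, Continuous (θ a) := fun a ha =>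
    continuous_iff_continuousAt.2 fun z => (hder a ha z).continuousAt
  have hsq : ∀ a ∈ Finset.Icc 1 N, ∀ z, Real.sin (θ a z) ^ 2 = Real.sin (θ N z) ^ 2 :=
    fun a ha z => by rw [Real.sin_sq, Real.sin_sq, hcos a ha z]
  have hN2 : (((N / 2 : ℕ) : ℂ) / N) = ((1 / 2 : ℝ) : ℂ) := by
    obtain ⟨m, rfl⟩ := hNeven
    have : (m : ℂ) ≠ 0 := by norm_cast; omega
    have e : (m + m) / 2 = m := by omega
    rw [e]; push_cast; field_simp; ring
  have him : ∀ {l : Filter ℝ} {L : Fin N → ℝ} {M : Fin N → ℂ}, Tendsto x l (nhds M) →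
      (∀ i, M i = (L i : ℂ) * Complex.I) →
      Tendsto (fun z i => (x z i).im) l (nhds L) := fun {l L M} h hM => by
    refine tendsto_pi_nhds.2 fun i => ?_
    have := (Complex.continuous_im.tendsto _).comp (tendsto_pi_nhds.1 h i)
    simpa [Function.comp_def, hM i] using this
  have hbot : Tendsto (fun z i => (x z i).im) atBot (nhds fun i : Fin N =>
      2 * π * ∑ j ∈ Finset.Icc 1 (N - 1), c j * suWeight N j i) :=
    him hbc.1 fun i => by push_cast; ring
  have htop : Tendsto (fun z i => (x z i).im) atTop (nhds fun i : Fin N => π * weylVector N i) :=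
    him hbc.2 fun i => by rw [hN2]; push_cast; ring
  have hΔ : ∀ a, Tendsto (θ a) atBot (nhds (dotR (suRoot N a) (fun i =>
      2 * π * ∑ j ∈ Finset.Icc 1 (N - 1), c j * suWeight N j i))) ∧
      Tendsto (θ a) atTop (nhds (dotR (suRoot N a) (fun i =>
      2 * π * ∑ j ∈ Finset.Icc 1 (N - 1), c j * suWeight N j i) + dotR (suRoot N a) Δσ)) := by
    refine fun a => ⟨tendsto_dotR _ hbot, ?_⟩
    convert tendsto_dotR (suRoot N a) htop using 2
    rw [eq_comm, ← sub_eq_iff_eq_add', ← dotR_sub_right, hΔσ]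
    congr 1; funext i; ring
  have hcosbot : Tendsto (fun z => Real.cos (θ N z)) atBot (nhds 1) := by
    have h := (Real.continuous_cos.tendsto _).comp (hΔ N).1
    rw [dotR_smul_right, dotR_sum_right,
      Finset.sum_congr rfl fun j hj => by rw [dotR_affineRoot_suWeight hj]] at h
    have hint : ∃ n : ℤ, ∑ j ∈ Finset.Icc 1 (N - 1), c j * (-1) = n := by
      refine Finset.sum_induction _ (fun r : ℝ => ∃ n : ℤ, r = n) ?_ ⟨0, by simp⟩ fun j hj => ?_
      · rintro _ _ ⟨m, rfl⟩ ⟨n, rfl⟩; exact ⟨m + n, by push_cast; rfl⟩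
      · rcases hc j hj with h | h
        · exact ⟨0, by simp [h]⟩
        · exact ⟨-1, by simp [h]⟩
    obtain ⟨n, hn⟩ := hint
    rw [hn, mul_comm, Real.cos_int_mul_two_pi] at h
    exact h
  have hcostop : Tendsto (fun z => Real.cos (θ N z)) atTop (nhds (-1)) := by
    have h := (Real.continuous_cos.tendsto _).comp (tendsto_dotR (suRoot N N) htop)
    rw [dotR_smul_right, dotR_affineRoot_weylVector (by omega)] at h
    have e : Real.cos (π * (1 - N)) = -1 := by
      obtain ⟨m, rfl⟩ := hNeven
      have : π * (1 - ((m + m : ℕ) : ℝ)) = π - m * (2 * π) := by push_cast; ring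
      rw [this, Real.cos_sub_nat_mul_two_pi, Real.cos_pi]
    rw [e] at h
    exact h
  have hne : dotR (suRoot N N) Δσ ≠ 0 := fun h0 => by
    have h1 := (hΔ N).2
    rw [h0, add_zero] at h1
    have e1 := tendsto_nhds_unique hcosbot ((Real.continuous_cos.tendsto _).comp (hΔ N).1)
    have e2 := tendsto_nhds_unique hcostop ((Real.continuous_cos.tendsto _).comp h1)
    linarith
  have hsin : ∀ z, Real.sin (θ N z) ≠ 0 := fun z₀ h₀ => by
    have hconst : ∀ z, θ N z - θ N z₀ = 0 := by
      refine eq_zero_of_abs_deriv_le (K := 2) (z₀ := z₀)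
        (fun z => (hder N hNmem z).sub_const _) (fun z => ?_) (sub_self _)
      have hs : |Real.sin (θ N z)| ≤ |θ N z - θ N z₀| := by
        have hs' : |Real.sin (θ N z - θ N z₀)| = |Real.sin (θ N z)| := by
          have hc1 : |Real.cos (θ N z₀)| = 1 := by
            rcases Real.sin_eq_zero_iff_cos_eq.1 h₀ with h | h <;> simp [h]
          rw [Real.sin_sub, h₀, mul_zero, sub_zero, abs_mul, hc1, mul_one]
        rw [← hs']
        exact Real.abs_sin_le_abs
      have hp := sq_eq_sq_iff_abs_eq_abs _ _ |>.1 (hsq _ (hpred N hNmem) z)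
      have hq := sq_eq_sq_iff_abs_eq_abs _ _ |>.1 (hsq _ (hsucc N hNmem) z)
      have b1 := abs_le.1 hs
      have b2 := abs_le.1 (hp.trans_le hs)
      have b3 := abs_le.1 (hq.trans_le hs)
      have bound : ∀ {p q r T : ℝ}, -T ≤ p ∧ p ≤ T → -T ≤ q ∧ q ≤ T → -T ≤ r ∧ r ≤ T →
          |1 / 2 * (2 * p - q - r)| ≤ 2 * T := fun hp hq hr =>
        abs_le.2 ⟨by linarith [hp.1, hq.2, hr.2], by linarith [hp.2, hq.1, hr.1]⟩
      exact bound b1 b2 b3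
    have hc0 : ∀ z, Real.cos (θ N z) = Real.cos (θ N z₀) := fun z => by
      rw [sub_eq_zero.1 (hconst z)]
    simp only [hc0] at hcosbot hcostop
    have e1 := tendsto_nhds_unique hcosbot tendsto_const_nhds
    have e2 := tendsto_nhds_unique hcostop tendsto_const_nhds
    linarith
  have hd : ∀ a ∈ Finset.Icc 1 N, ∃ d : ℝ, (d = -1 ∨ d = 1) ∧
      ∀ z, Real.sin (θ a z) = d * Real.sin (θ N z) := fun a ha => by
    have h := isPreconnected_univ.eq_or_eq_neg_of_sq_eq
      (Real.continuous_sin.comp (hcont a ha)).continuousOn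
      (Real.continuous_sin.comp (hcont N hNmem)).continuousOn
      (fun z _ => hsq a ha z) (fun {z} _ => hsin z)
    rcases h with h | h
    · exact ⟨1, .inr rfl, fun z => by simpa using h (Set.mem_univ z)⟩
    · exact ⟨-1, .inl rfl, fun z => by simpa using h (Set.mem_univ z)⟩
  choose! d hd1 hd2 using hd
  have hdN : d N = 1 := by
    have := hd2 N hNmem 0
    exact mul_right_cancel₀ (hsin 0) (by rw [← this, one_mul])
  have hderiv : ∀ a ∈ Finset.Icc 1 N, ∀ z, HasDerivAt (θ a)
      (1 / 2 * (2 * d a - d (if a = 1 then N else a - 1) - d (if a = N then 1 else a + 1)) *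
        Real.sin (θ N z)) z := fun a ha z => by
    have h := hder a ha z
    rw [hd2 a ha, hd2 _ (hpred a ha), hd2 _ (hsucc a ha)] at h
    convert h using 1
    ring
  have hNpred : (if N = 1 then N else N - 1) = N - 1 := if_neg (by omega)
  have hCartan : ∀ a ∈ Finset.Icc 1 N,
      2 * d a - d (if a = 1 then N else a - 1) - d (if a = N then 1 else a + 1) =
        d a * (2 - d (N - 1) - d 1) := fun a ha => by
    have h1 := (hderiv a ha 0).cos
    have h2 := (hderiv N hNmem 0).cos
    have h3 : (fun z => Real.cos (θ a z)) = fun z => Real.cos (θ N z) := funext (hcos a ha)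
    rw [h3] at h1
    have h4 := h1.unique h2
    rw [hd2 a ha, hdN, hNpred, if_pos rfl] at h4
    have hs := pow_ne_zero 2 (hsin 0)
    have hda : d a * d a = 1 := by rcases hd1 a ha with h | h <;> rw [h] <;> norm_num
    have h5 : d a * (2 * d a - d (if a = 1 then N else a - 1) - d (if a = N then 1 else a + 1)) =
        2 - d (N - 1) - d 1 := mul_right_cancel₀ hs (by linear_combination -2 * h4)
    rw [← h5, ← mul_assoc, hda, one_mul]
  have hΔd : ∀ a ∈ Finset.Icc 1 N,
      dotR (suRoot N a) Δσ = d a * dotR (suRoot N N) Δσ := fun a ha => by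
    have hzero : ∀ z, HasDerivAt (fun z => θ a z - d a * θ N z) 0 z := fun z => by
      have h := (hderiv a ha z).sub ((hderiv N hNmem z).const_mul (d a))
      refine h.congr_deriv ?_
      rw [hCartan a ha, hCartan N hNmem, hdN]
      ring
    have hc0 : ∀ z, θ a z - d a * θ N z = θ a 0 - d a * θ N 0 := fun z =>
      is_const_of_deriv_eq_zero (fun z => (hzero z).differentiableAt)
        (fun z => (hzero z).deriv) z 0
    have t1 := (hΔ a).1.sub ((hΔ N).1.const_mul (d a))
    have t2 := (hΔ a).2.sub ((hΔ N).2.const_mul (d a))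
    simp only [hc0] at t1 t2
    have e1 := tendsto_nhds_unique t1 tendsto_const_nhds
    have e2 := tendsto_nhds_unique t2 tendsto_const_nhds
    linarith
  refine ⟨hne, d, hd1, hdN, hΔd, ?_, fun a ha => ?_⟩
  · have h := sum_dotR_suRoot Δσ
    rw [Finset.sum_congr rfl hΔd, ← Finset.sum_mul] at h
    exact (mul_eq_zero.1 h).resolve_right hne
  · have h := hCartan a ha
    rw [apply_ite d, apply_ite d] at h
    linarith
end
end

section
/- Let N ≥ 2 and let d_1,…,d_N be a sequence with each d_a ∈ {−1, 1} satisfying: (i) d_N = 1; (ii) Σ_{a=1}^N d_a = 0; (iii) d_a (d_{N−1} + d_1) = d_{a+1} + d_{a−1} for every a = 1,…,N, where indices are taken cyclically modulo N (d_0 = d_N, d_{N+1} = d_1). Then exactly one of the following holds for all a = 1,…,N: (alternating) d_a = (−1)^a; (positive paired) d_a = 1 if a mod 4 ∈ {0, 1} and d_a = −1 if a mod 4 ∈ {2, 3}; (negative paired) d_a = 1 if a mod 4 ∈ {0, 3} and d_a = −1 if a mod 4 ∈ {1, 2}. -/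
open Finset

/-- A second-order linear recurrence with initial values `1, d 1` determines `d` on `[1, N]`. -/
theorem eqOn_of_linear_recurrence {N : ℕ} {d f : ℕ → ℝ} {s : ℝ}
    (hrec : ∀ a, 1 ≤ a → a < N → d (a + 1) = s * d a - if a = 1 then 1 else d (a - 1))
    (hf0 : f 0 = 1) (hf1 : f 1 = d 1) (hf : ∀ a, f (a + 2) = s * f (a + 1) - f a) :
    ∀ a ∈ Finset.Icc 1 N, d a = f a := by
  intro a
  induction a using Nat.strong_induction_on with
  | _ a ih =>
    intro ha
    rw [Finset.mem_Icc] at ha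
    match a, ha with
    | 1, _ => exact hf1.symm
    | 2, ha => simpa [hf0, hf1, hf 0] using hrec 1 le_rfl ha.2
    | b + 3, ha =>
      have h1 := ih (b + 1) (by omega) (Finset.mem_Icc.2 (by omega))
      have h2 := ih (b + 2) (by omega) (Finset.mem_Icc.2 (by omega))
      have h3 := hrec (b + 2) (by omega) (by omega)
      simp only [Nat.reduceEqDiff, ↓reduceIte, Nat.add_one_sub_one] at h3
      rw [hf (b + 1), ← h1, ← h2, h3]

/-- a d-sequence satisfying the three conditions is exactly one of the
three types: alternating, positive paired, or negative paired. -/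
theorem dSequence_trichotomy (N : ℕ) (hN : 2 ≤ N) (d : ℕ → ℝ)
    (hd : ∀ a ∈ Finset.Icc 1 N, d a = -1 ∨ d a = 1)
    (hdN : d N = 1)
    (hsum : (∑ a ∈ Finset.Icc 1 N, d a) = 0)
    (hrec : ∀ a ∈ Finset.Icc 1 N,
      d a * (d (N - 1) + d 1) =
        (if a = N then d 1 else d (a + 1)) + (if a = 1 then d N else d (a - 1))) :
    ((∀ a ∈ Finset.Icc 1 N, d a = (-1 : ℝ) ^ a) ∧
        ¬(∀ a ∈ Finset.Icc 1 N, d a = if a % 4 = 0 ∨ a % 4 = 1 then 1 else -1) ∧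
        ¬(∀ a ∈ Finset.Icc 1 N, d a = if a % 4 = 0 ∨ a % 4 = 3 then 1 else -1)) ∨
    (¬(∀ a ∈ Finset.Icc 1 N, d a = (-1 : ℝ) ^ a) ∧
        (∀ a ∈ Finset.Icc 1 N, d a = if a % 4 = 0 ∨ a % 4 = 1 then 1 else -1) ∧
        ¬(∀ a ∈ Finset.Icc 1 N, d a = if a % 4 = 0 ∨ a % 4 = 3 then 1 else -1)) ∨
    (¬(∀ a ∈ Finset.Icc 1 N, d a = (-1 : ℝ) ^ a) ∧
        ¬(∀ a ∈ Finset.Icc 1 N, d a = if a % 4 = 0 ∨ a % 4 = 1 then 1 else -1) ∧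
        (∀ a ∈ Finset.Icc 1 N, d a = if a % 4 = 0 ∨ a % 4 = 3 then 1 else -1)) := by
  have hrec' : ∀ a, 1 ≤ a → a < N →
      d (a + 1) = (d (N - 1) + d 1) * d a - if a = 1 then 1 else d (a - 1) := by
    intro a h1 h2
    have h := hrec a (Finset.mem_Icc.2 ⟨h1, h2.le⟩)
    rw [if_neg h2.ne, hdN] at h
    linarith
  have m1 : 1 ∈ Finset.Icc 1 N := Finset.mem_Icc.2 ⟨le_rfl, by omega⟩
  have m2 : 2 ∈ Finset.Icc 1 N := Finset.mem_Icc.2 ⟨by omega, hN⟩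
  have h2 := hrec' 1 le_rfl hN
  simp only [↓reduceIte, Nat.reduceAdd] at h2
  rcases hd (N - 1) (Finset.mem_Icc.2 ⟨by omega, by omega⟩) with hl | hl <;>
    rcases hd 1 m1 with h1 | h1 <;> rw [hl, h1] at hrec' h2
  · refine Or.inl ⟨eqOn_of_linear_recurrence hrec' (by norm_num) (by norm_num [h1])
      (fun a => by ring), fun h => ?_, fun h => ?_⟩
    · have := h 1 m1
      norm_num [h1] at this
    · have := h 2 m2
      norm_num [h2] at this
  · refine Or.inr (Or.inl ⟨fun h => ?_, eqOn_of_linear_recurrence hrec' (by norm_num)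
      (by norm_num [h1]) (fun a => ?_), fun h => ?_⟩)
    · have := h 1 m1
      norm_num [h1] at this
    · split_ifs <;> first | omega | norm_num
    · have := h 1 m1
      norm_num [h1] at this
  · refine Or.inr (Or.inr ⟨fun h => ?_, fun h => ?_, eqOn_of_linear_recurrence hrec' (by norm_num)
      (by norm_num [h1]) (fun a => ?_)⟩)
    · have := h 2 m2
      norm_num [h2] at this
    · have := h 1 m1
      norm_num [h1] at this
    · split_ifs <;> first | omega | norm_num
  · have h := eqOn_of_linear_recurrence (f := fun _ => 1) hrec' rfl h1.symm (fun a => by norm_num)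
    rw [Finset.sum_congr rfl h] at hsum
    simp at hsum
    omega
end

section
/- Define f : ℝ → ℝ by f(y) = √2 · arctan(e^{−2y}). Then: (i) f′(y) = −√2 · sin(√2 · f(y)) for all y ∈ ℝ; (ii) f″(y) = √2 · sin(2√2 · f(y)) for all y ∈ ℝ; (iii) f(y) → π/√2 as y → −∞ and f(y) → 0 as y → +∞. -/
open Real Filter

theorem sin_two_mul_arctan (x : ℝ) : sin (2 * arctan x) = 2 * x / (1 + x ^ 2) := by
  have h : 0 < 1 + x ^ 2 := by positivity
  rw [sin_two_mul, sin_arctan, cos_arctan]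
  field_simp
  rw [sq_sqrt h.le]

/-- the exact SU(2) BPS domain wall profile
`f(y) = √2 · arctan(e^{-2y})` satisfies the first-order BPS equation
`f' = -√2 sin(√2 f)`, the second-order equation `f'' = √2 sin(2√2 f)`,
and interpolates between the vacua `π/√2` (at `-∞`) and `0` (at `+∞`). -/
theorem su2_BPS_wall_profile (f : ℝ → ℝ)
    (hf : ∀ y, f y = Real.sqrt 2 * Real.arctan (Real.exp (-2 * y))) :
    (∀ y, HasDerivAt f (-Real.sqrt 2 * Real.sin (Real.sqrt 2 * f y)) y) ∧
    (∀ y, HasDerivAt (deriv f) (Real.sqrt 2 * Real.sin (2 * Real.sqrt 2 * f y)) y) ∧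
    Tendsto f atBot (nhds (π / Real.sqrt 2)) ∧
    Tendsto f atTop (nhds 0) := by
  obtain rfl : f = fun y => √2 * arctan (exp (-2 * y)) := funext hf
  have h2 : √2 * √2 = 2 := mul_self_sqrt zero_le_two
  have first (y : ℝ) : HasDerivAt (fun y => √2 * arctan (exp (-2 * y)))
      (-√2 * sin (√2 * (√2 * arctan (exp (-2 * y))))) y := by
    rw [← mul_assoc √2 √2, h2, sin_two_mul_arctan]
    refine ((((hasDerivAt_id' y).const_mul (-2)).exp.arctan).const_mul √2).congr_deriv ?_
    ring
  refine ⟨first, fun y => ?_, ?_, ?_⟩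
  · rw [funext fun y => (first y).deriv]
    refine ((((first y).const_mul √2).sin).const_mul (-√2)).congr_deriv ?_
    rw [mul_assoc 2 √2, sin_two_mul]
    linear_combination
      √2 * sin (√2 * (√2 * arctan (exp (-2 * y)))) *
        cos (√2 * (√2 * arctan (exp (-2 * y)))) * h2
  · have hexp : Tendsto (fun y : ℝ => exp (-2 * y)) atBot atTop :=
      tendsto_exp_atTop.comp (tendsto_id.const_mul_atBot_of_neg (by norm_num))
    have hvac : π / √2 = √2 * (π / 2) := by
      field_simp
      linear_combination -h2
    rw [hvac]
    exact ((tendsto_arctan_atTop.mono_right nhdsWithin_le_nhds).comp hexp).const_mul √2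
  · have hexp : Tendsto (fun y : ℝ => exp (-2 * y)) atTop (nhds 0) :=
      tendsto_exp_atBot.comp (tendsto_id.const_mul_atTop_of_neg (by norm_num))
    simpa using ((continuous_arctan.tendsto 0).comp hexp).const_mul √2
end

section
/- Let N ≥ 2, let α_a = e_a − e_{a+1} for a = 1,…,N−1 and α_N = e_N − e_1 in ℝ^N ⊂ ℂ^N, let ρ = w_1 + ⋯ + w_{N−1} be the Weyl vector, and define W : ℂ^N → ℂ by W(x) = Σ_{a=1}^N exp(α_a · x) (complex-bilinear dot product). For each integer k with 0 ≤ k ≤ N−1, set x_k = (2πik/N) ρ. Then exp(α_a · x_k) = exp(2πik/N) for every a = 1,…,N; consequently Σ_{a=1}^N exp(α_a · x_k) α_a = 0 (so x_k is a critical point of W) and W(x_k) = N exp(2πik/N). -/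
open Finset

noncomputable section

theorem sum_Icc_indicator_le (i m : ℕ) (h : i ≤ m) :
    ∑ b ∈ Icc 1 m, (if i + 1 ≤ b then (1 : ℝ) else 0) = m - i := by
  have hf : (Icc 1 m).filter (fun b => i + 1 ≤ b) = Icc (i + 1) m := by
    ext b
    simp only [mem_filter, mem_Icc]
    omega
  rw [Finset.sum_boole, hf, Nat.card_Icc, Nat.add_sub_add_right, Nat.cast_sub h]

theorem weylVector_sub (N : ℕ) (i j : Fin N) :
    weylVector N i - weylVector N j = (j : ℝ) - i := by
  have hi := i.isLt
  have hj := j.isLt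
  simp only [weylVector, suWeight, sum_sub_distrib]
  rw [sum_Icc_indicator_le i (N - 1) (by omega), sum_Icc_indicator_le j (N - 1) (by omega)]
  ring

theorem dotC_suRoot {N : ℕ} (hN : 0 < N) (y : Fin N → ℂ) (i : Fin N) :
    dotC (suRoot N (i + 1)) y = y i - y ⟨(i + 1) % N, Nat.mod_lt _ hN⟩ := by
  have h1 (j : Fin N) : (j : ℕ) + 1 = i + 1 ↔ j = i := by
    rw [Nat.add_right_cancel_iff, Fin.ext_iff]
  have h2 (j : Fin N) : (j : ℕ) + 1 = (i + 1) % N + 1 ↔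
      j = ⟨(i + 1) % N, Nat.mod_lt _ hN⟩ := by
    rw [Nat.add_right_cancel_iff, Fin.ext_iff]
  simp only [dotC, suRoot, h1, h2]
  simp [sub_mul, sum_sub_distrib, apply_ite Complex.ofReal]

theorem sum_suRoot (N : ℕ) (i : Fin N) : ∑ a ∈ Icc 1 N, suRoot N a i = 0 := by
  have hi := i.isLt
  have h (a : ℕ) (ha : a ∈ Icc 1 N) :
      (i : ℕ) + 1 = a % N + 1 ↔ (if (i : ℕ) = 0 then N else i) = a := by
    rw [mem_Icc] at ha
    rcases ha.2.lt_or_eq with h | rfl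
    · rw [Nat.mod_eq_of_lt h]
      split_ifs <;> omega
    · rw [Nat.mod_self]
      split_ifs <;> omega
  simp only [suRoot, sum_sub_distrib]
  rw [sum_congr rfl fun a ha => if_congr (h a ha) rfl rfl, sum_ite_eq, sum_ite_eq,
    if_pos (mem_Icc.2 (by omega)), if_pos (mem_Icc.2 (by split_ifs <;> omega)), sub_self]

theorem exp_dotC_suRoot {N : ℕ} (hN : 0 < N) (k : ℕ) {a : ℕ} (ha : a ∈ Icc 1 N) :
    Complex.exp (dotC (suRoot N a) fun i =>
        2 * (Real.pi : ℂ) * Complex.I * (k : ℂ) / (N : ℂ) * (weylVector N i : ℂ)) =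
      Complex.exp (2 * (Real.pi : ℂ) * Complex.I * (k : ℂ) / (N : ℂ)) := by
  rw [mem_Icc] at ha
  obtain ⟨i, rfl⟩ := Nat.exists_eq_add_of_le' ha.1
  have hN' : (N : ℂ) ≠ 0 := Nat.cast_ne_zero.2 hN.ne'
  rw [dotC_suRoot hN _ ⟨i, ha.2⟩, ← mul_sub, ← Complex.ofReal_sub, weylVector_sub]
  rcases ha.2.lt_or_eq with h | rfl
  · congr 1
    simp [Nat.mod_eq_of_lt h]
  · rw [Complex.exp_eq_exp_iff_exists_int]
    refine ⟨-k, ?_⟩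
    simp only [Nat.mod_self]
    push_cast at hN' ⊢
    field_simp
    ring

/-- the points `x_k = (2πik/N)ρ` are the `N` vacua:
`exp(α_a · x_k) = exp(2πik/N)` for all `a`, hence `x_k` is a critical point of the
superpotential `W(x) = ∑_a exp(α_a · x)` and `W(x_k) = N exp(2πik/N)`. -/
theorem vacua_of_superpotential (N : ℕ) (hN : 2 ≤ N) (k : ℕ) (hk : k ≤ N - 1)
    (xk : Fin N → ℂ)
    (hxk : xk = fun i => 2 * (Real.pi : ℂ) * Complex.I * (k : ℂ) / (N : ℂ) * (weylVector N i : ℂ)) :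
    (∀ a ∈ Finset.Icc 1 N,
      Complex.exp (dotC (suRoot N a) xk) =
        Complex.exp (2 * (Real.pi : ℂ) * Complex.I * (k : ℂ) / (N : ℂ))) ∧
    (∀ i : Fin N,
      (∑ a ∈ Finset.Icc 1 N, Complex.exp (dotC (suRoot N a) xk) * (suRoot N a i : ℂ)) = 0) ∧
    (∑ a ∈ Finset.Icc 1 N, Complex.exp (dotC (suRoot N a) xk)) =
      (N : ℂ) * Complex.exp (2 * (Real.pi : ℂ) * Complex.I * (k : ℂ) / (N : ℂ)) := by
  subst hxk
  have hexp := fun a (ha : a ∈ Icc 1 N) => exp_dotC_suRoot (by omega) k ha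
  refine ⟨hexp, fun i => ?_, ?_⟩
  · rw [sum_congr rfl fun a ha => congrArg (· * (suRoot N a i : ℂ)) (hexp a ha), ← mul_sum,
      ← Complex.ofReal_sum, sum_suRoot, Complex.ofReal_zero, mul_zero]
  · rw [sum_congr rfl hexp, sum_const, Nat.card_Icc, Nat.add_sub_cancel, nsmul_eq_mul]
end
end

section
/- Let N ≥ 2, let P : ℝ^N → ℝ^N be the cyclic coordinate permutation determined by P e_i = e_{i+1 (mod N)}, let k be an integer, let S ⊆ {1,…,N−1} with |S| = m, and set Φ = Σ_{j∈S} w_j − (k/N) ρ. Then for every integer l with 1 ≤ l ≤ N−1: P^l Φ = Σ_{j∈S} w_{(j+l) mod N} + (k − m) w_l − (k/N) ρ (conventions w_0 = w_N = 0), and moreover the index l does not occur among the residues (j + l) mod N for j ∈ S, so the coefficient of w_l in the weight-basis expansion of P^l Φ + (k/N) ρ is exactly k − m. -/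
open Finset

noncomputable section

/-- The cyclic coordinate permutation `P` realizing the 0-form ℤ_N center symmetry:
`P e_i = e_{i+1 (mod N)}`, i.e. `(P v) i = v (i - 1 mod N)`. -/
def cyclicP (N : ℕ) (v : Fin N → ℝ) : Fin N → ℝ := fun i =>
  v ⟨((i : ℕ) + (N - 1)) % N, Nat.mod_lt _ i.pos⟩

theorem cyclicP_iterate_apply {N l : ℕ} (hl : l ≤ N) (v : Fin N → ℝ) (i : Fin N) :
    (cyclicP N)^[l] v i = v ⟨((i : ℕ) + (N - l)) % N, Nat.mod_lt _ i.pos⟩ := by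
  induction l generalizing i with
  | zero =>
    simp [Nat.mod_eq_of_lt i.isLt]
  | succ l ih =>
    rw [Function.iterate_succ_apply']
    simp only [cyclicP]
    rw [ih (by omega)]
    congr 2
    rw [Nat.mod_add_mod, show (i : ℕ) + (N - 1) + (N - l) = i + (N - (l + 1)) + N by omega,
      Nat.add_mod_right]

/-- The position that `P^l` moves to `i`, without reduction modulo `N`. -/
theorem add_sub_mod_eq_ite {N l i : ℕ} (hl : l ≤ N) (hl0 : 1 ≤ l) (hi : i < N) :
    (i + (N - l)) % N = if l ≤ i then i - l else i + N - l := by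
  split_ifs with h
  · rw [show i + (N - l) = i - l + N by omega, Nat.add_mod_right, Nat.mod_eq_of_lt (by omega)]
  · rw [Nat.mod_eq_of_lt (by omega)]
    omega

theorem add_mod_eq_ite {N j l : ℕ} (hj : j < N) (hl : l < N) :
    (j + l) % N = if j + l < N then j + l else j + l - N := by
  split_ifs with h
  · exact Nat.mod_eq_of_lt h
  · rw [Nat.mod_eq_sub_mod (by omega), Nat.mod_eq_of_lt (by omega)]

theorem cyclicP_iterate_suWeight {N j l : ℕ} (hj : j < N) (hl0 : 1 ≤ l) (hl : l < N)
    (i : Fin N) :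
    (cyclicP N)^[l] (suWeight N j) i = suWeight N ((j + l) % N) i - suWeight N l i := by
  have hi := i.isLt
  have hN : (N : ℝ) ≠ 0 := by
    have : N ≠ 0 := by omega
    exact_mod_cast this
  rw [cyclicP_iterate_apply hl.le, add_mod_eq_ite hj hl]
  simp only [suWeight, add_sub_mod_eq_ite hl.le hl0 hi]
  by_cases h : j + l < N
  · simp only [h, if_true, Nat.cast_add]
    split_ifs <;> first | omega | (field_simp; ring)
  · simp only [h, if_false, Nat.cast_sub (not_lt.mp h), Nat.cast_add]
    split_ifs <;> first | omega | (field_simp; ring)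

theorem sum_suWeight_add_mod {N l : ℕ} (hl0 : 1 ≤ l) (hl : l < N) (i : Fin N) :
    ∑ j ∈ Finset.Icc 1 (N - 1), suWeight N ((j + l) % N) i =
      weylVector N i - suWeight N l i := by
  have hzero : suWeight N 0 i = 0 := by simp [suWeight]
  have hrange (f : ℕ → ℝ) :
      ∑ j ∈ Finset.range N, f j = f 0 + ∑ j ∈ Finset.Icc 1 (N - 1), f j := by
    have : Finset.range N = insert 0 (Finset.Icc 1 (N - 1)) := by
      ext x
      simp only [Finset.mem_range, Finset.mem_insert, Finset.mem_Icc]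
      omega
    rw [this, Finset.sum_insert (by simp)]
  have hshift : ∑ j ∈ Finset.range N, suWeight N ((j + l) % N) i =
      ∑ j ∈ Finset.range N, suWeight N j i := by
    refine Finset.sum_nbij' (fun j => (j + l) % N) (fun j => (j + (N - l)) % N) ?_ ?_ ?_ ?_ ?_
    · intro j _
      exact Finset.mem_range.mpr (Nat.mod_lt _ (by omega))
    · intro j _
      exact Finset.mem_range.mpr (Nat.mod_lt _ (by omega))
    · intro j hj
      rw [Nat.mod_add_mod, show j + l + (N - l) = j + N by omega, Nat.add_mod_right,
        Nat.mod_eq_of_lt (Finset.mem_range.mp hj)]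
    · intro j hj
      rw [Nat.mod_add_mod, show j + (N - l) + l = j + N by omega, Nat.add_mod_right,
        Nat.mod_eq_of_lt (Finset.mem_range.mp hj)]
    · intro j _
      rfl
  rw [hrange, hrange, zero_add, Nat.mod_eq_of_lt hl, hzero] at hshift
  simp only [weylVector]
  linarith

theorem sum_cyclicP_iterate_suWeight {N l : ℕ} {T : Finset ℕ} (hT : T ⊆ Finset.Icc 1 (N - 1))
    (hl0 : 1 ≤ l) (hl : l < N) (i : Fin N) :
    ∑ j ∈ T, (cyclicP N)^[l] (suWeight N j) i =
      ∑ j ∈ T, suWeight N ((j + l) % N) i - T.card * suWeight N l i := by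
  rw [← nsmul_eq_mul, ← Finset.sum_const, ← Finset.sum_sub_distrib]
  refine Finset.sum_congr rfl fun j hj => cyclicP_iterate_suWeight ?_ hl0 hl i
  have := Finset.mem_Icc.mp (hT hj)
  omega

theorem cyclicP_iterate_weylVector {N l : ℕ} (hl0 : 1 ≤ l) (hl : l < N) (i : Fin N) :
    (cyclicP N)^[l] (weylVector N) i = weylVector N i - N * suWeight N l i := by
  have h := sum_cyclicP_iterate_suWeight (Finset.Subset.refl (Finset.Icc 1 (N - 1))) hl0 hl i
  rw [sum_suWeight_add_mod hl0 hl, Nat.card_Icc, Nat.add_sub_cancel,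
    Nat.cast_sub (by omega), Nat.cast_one] at h
  simp only [cyclicP_iterate_apply hl.le] at h ⊢
  simp only [weylVector] at h ⊢
  linarith

/-- the action of the center symmetry on a `k`-wall flux
`Φ = ∑_{j∈S} w_j - (k/N)ρ`: we have
`P^l Φ = ∑_{j∈S} w_{(j+l) mod N} + (k - m) w_l - (k/N)ρ`, and the index `l` does not
occur among the residues `(j+l) mod N` for `j ∈ S`, so the coefficient of `w_l` in
the weight-basis expansion is exactly `k - m`. -/
theorem center_action_on_flux (N : ℕ) (hN : 2 ≤ N) (k : ℤ)
    (S : Finset ℕ) (hS : S ⊆ Finset.Icc 1 (N - 1)) (m : ℕ) (hm : S.card = m)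
    (Φ : Fin N → ℝ)
    (hΦ : Φ = fun i => (∑ j ∈ S, suWeight N j i) - (k : ℝ) / N * weylVector N i) :
    ∀ l ∈ Finset.Icc 1 (N - 1),
      ((cyclicP N)^[l] Φ =
        fun i => (∑ j ∈ S, suWeight N ((j + l) % N) i) + ((k : ℝ) - m) * suWeight N l i -
          (k : ℝ) / N * weylVector N i) ∧
      (∀ j ∈ S, (j + l) % N ≠ l) := by
  subst hm hΦ
  intro l hl
  obtain ⟨hl0, hl1⟩ := Finset.mem_Icc.mp hl
  have hlN : l < N := by omega
  refine ⟨?_, ?_⟩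
  · funext i
    have hsum := sum_cyclicP_iterate_suWeight hS hl0 hlN i
    have hweyl := cyclicP_iterate_weylVector hl0 hlN i
    have hN0 : (N : ℝ) ≠ 0 := by
      have : N ≠ 0 := by omega
      exact_mod_cast this
    simp only [cyclicP_iterate_apply hlN.le] at hsum hweyl ⊢
    rw [hsum, hweyl]
    field_simp
    ring
  · intro j hj
    have hjN := Finset.mem_Icc.mp (hS hj)
    rw [add_mod_eq_ite (by omega) hlN]
    split_ifs <;> omega
end
end

section
/- Let N ≥ 2, let P : ℝ^N → ℝ^N be the cyclic coordinate permutation determined by P e_i = e_{i+1 (mod N)}, let k be an integer with 1 ≤ k ≤ N−1, let S ⊆ {1,…,N−1} with |S| = m, and set Φ = Σ_{j∈S} w_j − (k/N) ρ. Suppose that for every l with 1 ≤ l ≤ N−1 there exists a subset S′ ⊆ {1,…,N−1} with P^l Φ = Σ_{j∈S′} w_j − (k/N) ρ (i.e., all iterates of P keep the flux in the fundamental domain, where each fundamental weight has coefficient 0 or 1). Then m = k or m = k − 1. -/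
open Finset

noncomputable section

theorem sum_suWeight_zero_sub_one (N : ℕ) (h0 : 0 < N) (h1 : 1 < N) (T : Finset ℕ)
    (hT : T ⊆ Finset.Icc 1 (N - 1)) :
    ∑ j ∈ T, suWeight N j ⟨0, h0⟩ - ∑ j ∈ T, suWeight N j ⟨1, h1⟩ = if 1 ∈ T then 1 else 0 := by
  rw [← Finset.sum_sub_distrib, ← Finset.sum_ite_eq T 1 fun _ => (1 : ℝ)]
  refine Finset.sum_congr rfl fun j hj => ?_
  have hj' := Finset.mem_Icc.mp (hT hj)
  rcases eq_or_ne 1 j with rfl | hne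
  · simp [suWeight]
  · have h2 : 2 ≤ j := by omega
    simp [suWeight, hj'.1, hne, h2]

theorem sum_suWeight_last_sub_zero (N : ℕ) (h0 : 0 < N) (hlast : N - 1 < N) (T : Finset ℕ)
    (hT : T ⊆ Finset.Icc 1 (N - 1)) :
    ∑ j ∈ T, suWeight N j ⟨N - 1, hlast⟩ - ∑ j ∈ T, suWeight N j ⟨0, h0⟩ = -(T.card : ℝ) := by
  rw [← Finset.sum_sub_distrib, Finset.sum_congr rfl (g := fun _ => (-1 : ℝ))]
  · simp
  · intro j hj
    have hj' := Finset.mem_Icc.mp (hT hj)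
    have hlt : ¬ N - 1 + 1 ≤ j := by omega
    simp only [suWeight, if_neg hlt, zero_add, if_pos hj'.1]
    ring

/-- if every center image `P^l Φ` of the `k`-wall flux
`Φ = ∑_{j∈S} w_j - (k/N)ρ` stays in the fundamental domain (each fundamental weight
appearing with coefficient 0 or 1), then `m = |S|` equals `k` or `k - 1`. -/
theorem center_invariant_fluxes_have_k_or_km1_weights (N : ℕ) (hN : 2 ≤ N)
    (k : ℕ) (hk1 : 1 ≤ k) (hk2 : k ≤ N - 1)
    (S : Finset ℕ) (hS : S ⊆ Finset.Icc 1 (N - 1)) (m : ℕ) (hm : S.card = m)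
    (Φ : Fin N → ℝ)
    (hΦ : Φ = fun i => (∑ j ∈ S, suWeight N j i) - (k : ℝ) / N * weylVector N i)
    (hfund : ∀ l ∈ Finset.Icc 1 (N - 1), ∃ S' : Finset ℕ, S' ⊆ Finset.Icc 1 (N - 1) ∧
      (cyclicP N)^[l] Φ =
        fun i => (∑ j ∈ S', suWeight N j i) - (k : ℝ) / N * weylVector N i) :
    m = k ∨ m + 1 = k := by
  have h0 : 0 < N := by omega
  have h1 : 1 < N := by omega
  have hlast : N - 1 < N := by omega
  obtain ⟨T, hT, hPΦ⟩ := hfund 1 (Finset.mem_Icc.mpr ⟨le_rfl, by omega⟩)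
  rw [Function.iterate_one] at hPΦ
  have hP0 : cyclicP N Φ ⟨0, h0⟩ = Φ ⟨N - 1, hlast⟩ := by
    simp [cyclicP, Nat.mod_eq_of_lt hlast]
  have hP1 : cyclicP N Φ ⟨1, h1⟩ = Φ ⟨0, h0⟩ := by
    have hmod : (1 + (N - 1)) % N = 0 := by
      rw [Nat.add_sub_cancel' h1.le, Nat.mod_self]
    simp [cyclicP, hmod]
  rw [hPΦ, hΦ] at hP0 hP1
  beta_reduce at hP0 hP1
  have hT01 := sum_suWeight_zero_sub_one N h0 h1 T hT
  have hS0 := sum_suWeight_last_sub_zero N h0 hlast S hS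
  have hρ01 : weylVector N ⟨0, h0⟩ - weylVector N ⟨1, h1⟩ = 1 := by
    have hone : 1 ≤ N - 1 := by omega
    simpa [weylVector, hone] using sum_suWeight_zero_sub_one N h0 h1 _ subset_rfl
  have hρ0 : weylVector N ⟨N - 1, hlast⟩ - weylVector N ⟨0, h0⟩ = -((N : ℝ) - 1) := by
    have h := sum_suWeight_last_sub_zero N h0 hlast _ subset_rfl
    rwa [Nat.card_Icc, Nat.add_sub_cancel, Nat.cast_sub h1.le, Nat.cast_one] at h
  have hN0 : (N : ℝ) ≠ 0 := by exact_mod_cast h0.ne'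
  have hkN : (k : ℝ) / N * N = k := div_mul_cancel₀ _ hN0
  have key : (m : ℝ) + (if 1 ∈ T then 1 else 0) = k := by
    rw [← hT01, ← hm]
    linear_combination hP0 - hP1 + hS0 + (k : ℝ) / N * (hρ01 - hρ0) + hkN
  split_ifs at key
  · right
    exact_mod_cast key
  · left
    exact_mod_cast (add_zero (m : ℝ)).symm.trans key
end
end

section
/- Let N ≥ 2, let k be an integer with 1 ≤ k ≤ N−1, and let A be an integer with 1 ≤ A ≤ N. Let ν_A = w_A − w_{A−1} (with the convention w_0 = w_N = 0) be the A-th weight of the fundamental representation of SU(N). Then there exist subsets S, S′ ⊆ {1,…,N−1}, each of cardinality k or k−1, such that ν_A = (Σ_{j∈S′} w_j − (k/N) ρ) − (Σ_{j∈S} w_j − (k/N) ρ). In other words, every weight of the fundamental representation is the difference of two BPS k-wall fluxes. -/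
open Finset

noncomputable section

theorem suWeight_zero (N : ℕ) (i : Fin N) : suWeight N 0 i = 0 := by
  simp [suWeight]

theorem suWeight_self (N : ℕ) (i : Fin N) : suWeight N N i = 0 := by
  have hN : (N : ℝ) ≠ 0 := Nat.cast_ne_zero.mpr i.pos.ne'
  simp [suWeight, Nat.succ_le_of_lt i.isLt, div_self hN]

/-- every weight `ν_A = w_A - w_{A-1}` of the fundamental representation
is the difference of two BPS `k`-wall fluxes `∑_{j∈S} w_j - (k/N)ρ` with
`|S| ∈ {k, k-1}` (deconfinement of fundamental quarks on `k`-walls). -/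
theorem fundamental_weight_is_flux_difference (N : ℕ) (hN : 2 ≤ N)
    (k : ℕ) (hk1 : 1 ≤ k) (hk2 : k ≤ N - 1)
    (A : ℕ) (hA1 : 1 ≤ A) (hA2 : A ≤ N) :
    ∃ S S' : Finset ℕ, S ⊆ Finset.Icc 1 (N - 1) ∧ S' ⊆ Finset.Icc 1 (N - 1) ∧
      (S.card = k ∨ S.card + 1 = k) ∧ (S'.card = k ∨ S'.card + 1 = k) ∧
      ∀ i : Fin N, suWeight N A i - suWeight N (A - 1) i =
        ((∑ j ∈ S', suWeight N j i) - (k : ℝ) / N * weylVector N i) -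
        ((∑ j ∈ S, suWeight N j i) - (k : ℝ) / N * weylVector N i) := by
  rcases Nat.eq_or_lt_of_le hA1 with rfl | hA1'
  · obtain ⟨T, hT, hTc⟩ := Finset.exists_subset_card_eq
      (s := Finset.Icc 2 (N - 1)) (n := k - 1) (by rw [Nat.card_Icc]; omega)
    have h1 : 1 ∉ T := fun h => by simpa using hT h
    have hT' : T ⊆ Finset.Icc 1 (N - 1) := hT.trans (Finset.Icc_subset_Icc_left (by omega))
    refine ⟨T, insert 1 T, hT', Finset.insert_subset (by simp; omega) hT', by omega,
      by rw [Finset.card_insert_of_notMem h1]; omega, fun i => ?_⟩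
    rw [Finset.sum_insert h1, Nat.sub_self, suWeight_zero]
    ring
  rcases Nat.eq_or_lt_of_le hA2 with rfl | hA2'
  · obtain ⟨T, hT, hTc⟩ := Finset.exists_subset_card_eq
      (s := Finset.Icc 1 (A - 2)) (n := k - 1) (by rw [Nat.card_Icc]; omega)
    have h1 : A - 1 ∉ T := fun h => by have := Finset.mem_Icc.mp (hT h); omega
    have hT' : T ⊆ Finset.Icc 1 (A - 1) := hT.trans (Finset.Icc_subset_Icc_right (by omega))
    refine ⟨insert (A - 1) T, T, Finset.insert_subset (by simp; omega) hT', hT',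
      by rw [Finset.card_insert_of_notMem h1]; omega, by omega, fun i => ?_⟩
    rw [Finset.sum_insert h1, suWeight_self]
    ring
  have hcard : (((Finset.Icc 1 (N - 1)).erase A).erase (A - 1)).card = N - 3 := by
    rw [Finset.card_erase_of_mem (by simp; omega), Finset.card_erase_of_mem (by simp; omega),
      Nat.card_Icc]
    omega
  obtain ⟨T, hT, hTc⟩ := Finset.exists_subset_card_eq
    (s := ((Finset.Icc 1 (N - 1)).erase A).erase (A - 1)) (n := min (k - 1) (N - 3))
    (by rw [hcard]; exact min_le_right _ _)
  have h1 : A - 1 ∉ T := fun h => by simpa using hT h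
  have h2 : A ∉ T := fun h => by simpa using hT h
  have hT' : T ⊆ Finset.Icc 1 (N - 1) :=
    hT.trans ((Finset.erase_subset _ _).trans (Finset.erase_subset _ _))
  refine ⟨insert (A - 1) T, insert A T, Finset.insert_subset (by simp; omega) hT',
    Finset.insert_subset (by simp; omega) hT',
    by rw [Finset.card_insert_of_notMem h1]; omega,
    by rw [Finset.card_insert_of_notMem h2]; omega, fun i => ?_⟩
  rw [Finset.sum_insert h1, Finset.sum_insert h2]
  ring
end
end
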